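/- (Structure identification) Let m ∈ ℕ^ℓ, m ≠ 0, let 𝔑 be a factorization structure of degree m, let f̃ ∈ F^𝔑, and let f ∈ ℙ^m satisfy ‖f − f̃‖ < θ_{f̃}/2. Then for every ε with dist(f, F^𝔑) < ε < θ_{f̃}/2 one has codim(𝔑) = max{codim(𝔐) : 𝔐 a factorization structure of degree m with dist(f, F^𝔐) < ε}, and 𝔑 is the unique factorization structure of degree m with dist(f, F^𝔑) < ε attaining this maximum. -/

import Mathlib

open scoped Classical

/-- The Hermitian inner product on coefficients of multivariate polynomials
(conjugate-linear in the first argument). -/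
noncomputable def pInner {ℓ : ℕ} (p q : MvPolynomial (Fin ℓ) ℂ) : ℂ :=
  ∑ d ∈ p.support ∪ q.support, (starRingEnd ℂ) (MvPolynomial.coeff d p) * MvPolynomial.coeff d q

/-- The coefficient norm `‖p‖ := √⟪p,p⟫`. -/
noncomputable def pNorm {ℓ : ℕ} (p : MvPolynomial (Fin ℓ) ℂ) : ℝ :=
  Real.sqrt (pInner p p).re

/-- The sine of the principal angle between the spans of two polynomials. -/
noncomputable def psin {ℓ : ℕ} (p q : MvPolynomial (Fin ℓ) ℂ) : ℝ :=
  if p = 0 then (if q = 0 then 0 else 1)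
  else if q = 0 then 1
  else pNorm (((pNorm p : ℂ))⁻¹ • p -
        (pInner q p / ((pNorm q : ℂ) * (pNorm p : ℂ))) • (((pNorm q : ℂ))⁻¹ • q))

/-- `(r, mdeg, k)` is a factorization structure of degree `m`: `r ≥ 1`, each `mdeg j ≠ 0`,
each `k j ≥ 1` and `Σ_j k_j · mdeg_j = m`. -/
def IsStruct {ℓ : ℕ} (m : Fin ℓ → ℕ) (r : ℕ) (mdeg : Fin r → Fin ℓ → ℕ)
    (k : Fin r → ℕ) : Prop :=
  1 ≤ r ∧ (∀ j, mdeg j ≠ 0) ∧ (∀ j, 1 ≤ k j) ∧ (∀ t, ∑ j, k j * mdeg j t = m t)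

/-- The factorization manifold `F^𝔐` of the structure `𝔐 = ((mdeg 1, k 1),…,(mdeg r, k r))`. -/
def FMset {ℓ : ℕ} (r : ℕ) (mdeg : Fin r → Fin ℓ → ℕ) (k : Fin r → ℕ) :
    Set (MvPolynomial (Fin ℓ) ℂ) :=
  {f | ∃ (β : ℂ) (g : Fin r → MvPolynomial (Fin ℓ) ℂ), β ≠ 0 ∧
        (∀ i, Irreducible (g i)) ∧
        (∀ i t, (g i).degreeOf t = mdeg i t) ∧
        (∀ i j : Fin r, i ≠ j → ¬ Associated (g i) (g j)) ∧
        f = MvPolynomial.C β * ∏ i, g i ^ k i}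

/-- `⟨n⟩ = ∏_t (n_t + 1)`, the dimension of `ℙ^n`. -/
def dimC {ℓ : ℕ} (n : Fin ℓ → ℕ) : ℕ := ∏ t, (n t + 1)

/-- The codimension `⟨m⟩ − (⟨m_1⟩ + ⋯ + ⟨m_r⟩ + 1 − r)` of a factorization manifold. -/
def codimOf {ℓ : ℕ} (m : Fin ℓ → ℕ) {r : ℕ} (mdeg : Fin r → Fin ℓ → ℕ) : ℤ :=
  (dimC m : ℤ) - ((∑ j, (dimC (mdeg j) : ℤ)) + 1 - r)

/-- `dist(f, S) = inf_{g ∈ S} ‖f − g‖`, with value `+∞` for `S = ∅`. -/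
noncomputable def distE {ℓ : ℕ} (f : MvPolynomial (Fin ℓ) ℂ)
    (S : Set (MvPolynomial (Fin ℓ) ℂ)) : ENNReal :=
  ⨅ g ∈ S, ENNReal.ofReal (pNorm (f - g))

/-- Closure of a set of polynomials in the coefficient-norm topology. -/
def pclosure {ℓ : ℕ} (S : Set (MvPolynomial (Fin ℓ) ℂ)) : Set (MvPolynomial (Fin ℓ) ℂ) :=
  {f | ∀ ε : ℝ, 0 < ε → ∃ g ∈ S, pNorm (f - g) < ε}

/-- The critical gap `θ_f`: the infimum of `dist(f, F^𝔐)` over all factorization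
structures `𝔐` of degree `m` with `f ∉ closure(F^𝔐)` (`+∞` if there are none). -/
noncomputable def theta {ℓ : ℕ} (m : Fin ℓ → ℕ) (f : MvPolynomial (Fin ℓ) ℂ) : ENNReal :=
  ⨅ (r : ℕ) (mdeg : Fin r → Fin ℓ → ℕ) (k : Fin r → ℕ)
    (_ : IsStruct m r mdeg k) (_ : f ∉ pclosure (FMset r mdeg k)),
    distE f (FMset r mdeg k)

/-- `α·f_1^{k_1}⋯f_r^{k_r}` is a numerical irreducible factorization of `f` within `ε`:
the `f_j` are irreducible and pairwise non-associated, the structure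
`𝔐 = ((deg f_1,k_1),…,(deg f_r,k_r))` is a factorization structure of degree `m` of
maximal codimension among structures `𝔑` of degree `m` with `dist(f,F^𝔑) < ε`, and
`min_γ ‖f − γ·f_1^{k_1}⋯f_r^{k_r}‖` is attained and equals `dist(f,F^𝔐) < ε`. -/
noncomputable def IsNIF {ℓ : ℕ} (m : Fin ℓ → ℕ) (f : MvPolynomial (Fin ℓ) ℂ) (ε : ℝ)
    (α : ℂ) (r : ℕ) (fs : Fin r → MvPolynomial (Fin ℓ) ℂ) (ks : Fin r → ℕ) : Prop :=
  α ≠ 0 ∧ (∀ j, Irreducible (fs j)) ∧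
  (∀ i j : Fin r, i ≠ j → ¬ Associated (fs i) (fs j)) ∧
  IsStruct m r (fun j t => (fs j).degreeOf t) ks ∧
  (∀ (r' : ℕ) (mdeg' : Fin r' → Fin ℓ → ℕ) (k' : Fin r' → ℕ),
    IsStruct m r' mdeg' k' → distE f (FMset r' mdeg' k') < ENNReal.ofReal ε →
    codimOf m mdeg' ≤ codimOf m (fun j t => (fs j).degreeOf t)) ∧
  (∃ γ : ℂ,
    (∀ γ' : ℂ, pNorm (f - MvPolynomial.C γ * ∏ j, fs j ^ ks j) ≤
      pNorm (f - MvPolynomial.C γ' * ∏ j, fs j ^ ks j)) ∧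
    ENNReal.ofReal (pNorm (f - MvPolynomial.C γ * ∏ j, fs j ^ ks j)) =
      distE f (FMset r (fun j t => (fs j).degreeOf t) ks)) ∧
  distE f (FMset r (fun j t => (fs j).degreeOf t) ks) < ENNReal.ofReal ε

/-- The full factor list (each factor repeated with its multiplicity) of a factorization. -/
def fullList {ℓ : ℕ} (r : ℕ) (fs : Fin r → MvPolynomial (Fin ℓ) ℂ) (ks : Fin r → ℕ) :
    List (MvPolynomial (Fin ℓ) ℂ) :=
  (List.ofFn fun j => List.replicate (ks j) (fs j)).flatten

/-- The distance between two factorizations given by their full factor lists: `1` if the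
lengths differ, otherwise the minimum over permutations `σ` of `max_j sin(p_j, q_{σ(j)})`. -/
noncomputable def factDistL {ℓ : ℕ} (l₁ l₂ : List (MvPolynomial (Fin ℓ) ℂ)) : ℝ :=
  if h : l₁.length = l₂.length then
    if h0 : 0 < l₁.length then
      (Finset.univ : Finset (Equiv.Perm (Fin l₁.length))).inf' ⟨1, Finset.mem_univ _⟩
        (fun σ => (Finset.univ : Finset (Fin l₁.length)).sup' ⟨⟨0, h0⟩, Finset.mem_univ _⟩
          (fun j => psin (l₁.get j) (l₂.get (Fin.cast h (σ j)))))
    else 0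
  else 1

section Weight

variable {ℓ : ℕ}

/-- The weight `⟨n⟩ - 1` of a multidegree. -/
def degWeight (n : Fin ℓ → ℕ) : ℤ := (dimC n : ℤ) - 1

lemma codimOf_eq_sub_sum_degWeight (m : Fin ℓ → ℕ) {r : ℕ} (mdeg : Fin r → Fin ℓ → ℕ) :
    codimOf m mdeg = degWeight m - ∑ j, degWeight (mdeg j) := by
  simp only [codimOf, degWeight, Finset.sum_sub_distrib, Finset.sum_const, Finset.card_univ,
    Fintype.card_fin, nsmul_eq_mul, mul_one]
  ring

lemma prod_add_one_superadditive {ι : Type*} (s : Finset ι) (a b : ι → ℕ) :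
    ∏ i ∈ s, (a i + 1) + ∏ i ∈ s, (b i + 1) ≤ ∏ i ∈ s, (a i + b i + 1) + 1 := by
  induction s using Finset.induction_on with
  | empty => simp
  | insert i s hi ih =>
    rw [Finset.prod_insert hi, Finset.prod_insert hi, Finset.prod_insert hi]
    have hA : ∏ i ∈ s, (a i + 1) ≤ ∏ i ∈ s, (a i + b i + 1) :=
      Finset.prod_le_prod' fun i _ => by omega
    have hB : ∏ i ∈ s, (b i + 1) ≤ ∏ i ∈ s, (a i + b i + 1) :=
      Finset.prod_le_prod' fun i _ => by omega
    nlinarith [Nat.mul_le_mul_left (a i) hA, Nat.mul_le_mul_left (b i) hB]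

lemma degWeight_add_le (a b : Fin ℓ → ℕ) :
    degWeight a + degWeight b ≤ degWeight (a + b) := by
  have h := prod_add_one_superadditive Finset.univ a b
  simp only [degWeight, dimC, Pi.add_apply]
  zify at h
  push_cast
  linarith

lemma degWeight_add_lt {a b : Fin ℓ → ℕ} {s t : Fin ℓ} (hst : s ≠ t) (ha : a s ≠ 0)
    (hb : b t ≠ 0) : degWeight a + degWeight b < degWeight (a + b) := by
  have key : dimC a + dimC b ≤ dimC (a + b) := by
    simp only [dimC, Pi.add_apply]
    rw [← Finset.mul_prod_erase _ _ (Finset.mem_univ s),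
      ← Finset.mul_prod_erase _ _ (Finset.mem_univ s),
      ← Finset.mul_prod_erase _ (fun i => a i + b i + 1) (Finset.mem_univ s)]
    have h := prod_add_one_superadditive (Finset.univ.erase s) a b
    have hA : ∏ i ∈ Finset.univ.erase s, (a i + 1) <
        ∏ i ∈ Finset.univ.erase s, (a i + b i + 1) :=
      Finset.prod_lt_prod (fun i _ => by omega) (fun i _ => by omega)
        ⟨t, by simp [hst.symm], by omega⟩
    have hB : ∏ i ∈ Finset.univ.erase s, (b i + 1) ≤
        ∏ i ∈ Finset.univ.erase s, (a i + b i + 1) :=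
      Finset.prod_le_prod' fun i _ => by omega
    have h1 : 1 ≤ a s := Nat.one_le_iff_ne_zero.2 ha
    nlinarith [Nat.mul_le_mul_left (a s) (Nat.succ_le_of_lt hA), Nat.mul_le_mul_left (b s) hB]
  simp only [degWeight]
  zify at key
  linarith

lemma degWeight_zero : degWeight (0 : Fin ℓ → ℕ) = 0 := by simp [degWeight, dimC]

lemma degWeight_pos {n : Fin ℓ → ℕ} (hn : n ≠ 0) : 0 < degWeight n := by
  obtain ⟨s, hs⟩ := Function.ne_iff.1 hn
  have : ∏ _t : Fin ℓ, 1 < ∏ t, (n t + 1) :=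
    Finset.prod_lt_prod (fun _ _ => one_pos) (fun i _ => by omega)
      ⟨s, Finset.mem_univ _, by simpa [Nat.pos_iff_ne_zero] using hs⟩
  simp only [Finset.prod_const_one] at this
  simp only [degWeight, dimC]
  zify at this
  push_cast
  linarith

lemma nsmul_degWeight_le (n : Fin ℓ → ℕ) (c : ℕ) :
    (c : ℤ) * degWeight n ≤ degWeight (c • n) := by
  induction c with
  | zero => simp [degWeight_zero]
  | succ c ih =>
    rw [succ_nsmul]
    have := degWeight_add_le (c • n) n
    push_cast
    linarith

lemma sum_degWeight_le {ι : Type*} (s : Finset ι) (a : ι → ℕ) (n : ι → Fin ℓ → ℕ) :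
    ∑ i ∈ s, (a i : ℤ) * degWeight (n i) ≤ degWeight (∑ i ∈ s, a i • n i) := by
  induction s using Finset.induction_on with
  | empty => simp [degWeight_zero]
  | insert i s hi ih =>
    rw [Finset.sum_insert hi, Finset.sum_insert hi]
    linarith [degWeight_add_le (a i • n i) (∑ i ∈ s, a i • n i), nsmul_degWeight_le (n i) (a i)]

/-- A multidegree all of whose nontrivial decompositions strictly increase the weight. -/
def StrictWeight (m : Fin ℓ → ℕ) : Prop :=
  ∀ a b : Fin ℓ → ℕ, a ≠ 0 → b ≠ 0 → a + b = m → degWeight a + degWeight b < degWeight m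

lemma sum_eq_one_of_sum_degWeight_eq {ι : Type*} [Fintype ι] {m : Fin ℓ → ℕ}
    (hm : m ≠ 0) (hs : StrictWeight m) {a : ι → ℕ} {n : ι → Fin ℓ → ℕ} (hn : ∀ i, n i ≠ 0)
    (hsum : ∑ i, a i • n i = m) (hw : ∑ i, (a i : ℤ) * degWeight (n i) = degWeight m) :
    ∃ i, a = Pi.single i 1 := by
  obtain ⟨i, hi⟩ : ∃ i, a i ≠ 0 := by
    by_contra! h
    exact hm (by simp [← hsum, h])
  refine ⟨i, ?_⟩
  set a' : ι → ℕ := fun l => a l - (Pi.single i 1 : ι → ℕ) l with ha'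
  have hadd : a = Pi.single i 1 + a' := by
    funext l
    rcases eq_or_ne l i with rfl | h
    · simp [ha']; omega
    · simp [ha', h]
  have hsplit : n i + ∑ l, a' l • n l = m := by
    rw [← hsum, hadd]
    simp [add_smul, Finset.sum_add_distrib, Pi.single_apply, ite_smul]
  have hwsplit : degWeight (n i) + ∑ l, (a' l : ℤ) * degWeight (n l) = degWeight m := by
    rw [← hw, hadd]
    simp [add_mul, Finset.sum_add_distrib, Pi.single_apply]
  have hzero : ∑ l, a' l • n l = 0 := by
    by_contra h
    have h1 := hs _ _ (hn i) h hsplit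
    have h2 := sum_degWeight_le Finset.univ a' n
    linarith
  have ha'0 : a' = 0 := by
    funext l
    have h := (Finset.sum_eq_zero_iff.1 hzero) l (Finset.mem_univ _)
    exact (smul_eq_zero.1 h).resolve_right (hn l)
  rw [hadd, ha'0, add_zero]

/-- If each `mdeg j` is an `ℕ`-combination of the `ndeg i` with coefficients `a j`, and every
`ndeg i` occurs, then the weights are ordered. -/
lemma sum_degWeight_le_sum_degWeight {ι κ : Type*} [Fintype ι] [Fintype κ]
    {mdeg : κ → Fin ℓ → ℕ} {ndeg : ι → Fin ℓ → ℕ} {a : κ → ι → ℕ}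
    (hn : ∀ i, ndeg i ≠ 0) (hsum : ∀ j, ∑ i, a j i • ndeg i = mdeg j)
    (hcover : ∀ i, ∃ j, a j i ≠ 0) :
    ∑ i, degWeight (ndeg i) ≤ ∑ j, degWeight (mdeg j) ∧
    (∑ i, degWeight (ndeg i) = ∑ j, degWeight (mdeg j) →
      (∀ j, mdeg j ≠ 0) → (∀ j, StrictWeight (mdeg j)) →
      ∃ σ : κ ≃ ι, ∀ j, a j = Pi.single (σ j) 1) := by
  have hcol : ∀ i, 1 ≤ ∑ j, a j i := fun i => by
    obtain ⟨j, hj⟩ := hcover i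
    exact (Nat.one_le_iff_ne_zero.2 hj).trans
      (Finset.single_le_sum (f := fun j => a j i) (fun _ _ => Nat.zero_le _) (Finset.mem_univ j))
  have h1 : ∀ i ∈ Finset.univ,
      degWeight (ndeg i) ≤ ((∑ j, a j i : ℕ) : ℤ) * degWeight (ndeg i) := fun i _ => by
    have h : (1 : ℤ) ≤ ((∑ j, a j i : ℕ) : ℤ) := by exact_mod_cast hcol i
    nlinarith [degWeight_pos (hn i)]
  have h2 : ∀ j ∈ Finset.univ, ∑ i, (a j i : ℤ) * degWeight (ndeg i) ≤ degWeight (mdeg j) :=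
    fun j _ => hsum j ▸ sum_degWeight_le Finset.univ (a j) ndeg
  have hswap : ∑ i, ((∑ j, a j i : ℕ) : ℤ) * degWeight (ndeg i) =
      ∑ j, ∑ i, (a j i : ℤ) * degWeight (ndeg i) := by
    rw [Finset.sum_comm]
    push_cast
    simp only [Finset.sum_mul]
  have hle1 := Finset.sum_le_sum h1
  have hle2 := Finset.sum_le_sum h2
  refine ⟨by linarith, fun heq hm hs => ?_⟩
  have e1 := (Finset.sum_eq_sum_iff_of_le h1).1 (by linarith)
  have e2 := (Finset.sum_eq_sum_iff_of_le h2).1 (by linarith)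
  have hcol1 : ∀ i, ∑ j, a j i = 1 := fun i => by
    have h := e1 i (Finset.mem_univ _)
    have h' := mul_right_cancel₀ (degWeight_pos (hn i)).ne' ((one_mul _).trans h)
    exact_mod_cast h'.symm
  choose σ hσ using fun j =>
    sum_eq_one_of_sum_degWeight_eq (hm j) (hs j) hn (hsum j) (e2 j (Finset.mem_univ _))
  have hcard : ∀ i, ∃! j, σ j = i := fun i => by
    have h := hcol1 i
    simp only [hσ, Pi.single_apply, Finset.sum_boole, Nat.cast_id] at h
    obtain ⟨j, hj⟩ := Finset.card_eq_one.1 h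
    have hmem : ∀ l, i = σ l ↔ l = j := fun l => by
      simpa using Finset.ext_iff.1 hj l
    exact ⟨j, ((hmem j).2 rfl).symm, fun l hl => (hmem l).1 hl.symm⟩
  exact ⟨Equiv.ofBijective σ (Function.bijective_iff_existsUnique σ |>.2 hcard), hσ⟩

end Weight

section Algebra

variable {ℓ : ℕ}

/-- A factor of `a * ∏ p i ^ k i` with all `p i` prime is a divisor of `a` times a product of
powers of the `p i`. -/
lemma exists_eq_mul_prod_pow_of_mul_eq {R ι : Type*} [CommMonoidWithZero R] [IsCancelMulZero R]
    {p : ι → R} {k : ι → ℕ} (s : Finset ι) (hp : ∀ i, Prime (p i)) {x y a : R}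
    (h : x * y = a * ∏ i ∈ s, p i ^ k i) :
    ∃ (e : ι → ℕ) (b : R), b ∣ a ∧ x = b * ∏ i ∈ s, p i ^ e i := by
  induction s using Finset.induction_on generalizing a with
  | empty => exact ⟨0, x, ⟨y, by simpa using h.symm⟩, by simp⟩
  | insert i s hi ih =>
    rw [Finset.prod_insert hi, ← mul_assoc] at h
    obtain ⟨e, b, ⟨c, hc⟩, rfl⟩ := ih h
    obtain ⟨u, v, b', c', -, rfl, rfl, -⟩ := mul_eq_mul_prime_pow (hp i) hc.symm
    refine ⟨Function.update e i u, b', dvd_mul_right _ _, ?_⟩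
    rw [Finset.prod_insert hi, Function.update_self, mul_assoc]
    congr 2
    exact Finset.prod_congr rfl fun l hl => by
      rw [Function.update_of_ne (ne_of_mem_of_not_mem hl hi)]

lemma emultiplicity_unit_mul_prod_pow {R ι : Type*} [CommMonoidWithZero R] [IsCancelMulZero R]
    [Fintype ι] {p : ι → R} {u : R} (hu : IsUnit u) (hp : ∀ i, Prime (p i))
    (hna : ∀ i j, i ≠ j → ¬ Associated (p i) (p j)) (k : ι → ℕ) (i : ι) :
    emultiplicity (p i) (u * ∏ l, p l ^ k l) = k i := by
  rw [emultiplicity_mul (hp i), Finset.emultiplicity_prod (hp i),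
    emultiplicity_eq_zero.2 fun h => (hp i).not_isUnit (isUnit_of_dvd_unit h hu), zero_add,
    Finset.sum_eq_single i]
  · exact emultiplicity_pow_self_of_prime (hp i) _
  · intro l _ hl
    refine emultiplicity_eq_zero.2 fun h => hna i l hl.symm ?_
    exact (hp i).associated_of_dvd (hp l) ((hp i).dvd_of_dvd_pow h)
  · simp

lemma degreeOf_C_mul_prod_pow {ι : Type*} [Fintype ι] {β : ℂ} (hβ : β ≠ 0)
    {g : ι → MvPolynomial (Fin ℓ) ℂ} (hg : ∀ i, g i ≠ 0) (k : ι → ℕ) (t : Fin ℓ) :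
    (MvPolynomial.C β * ∏ i, g i ^ k i).degreeOf t = ∑ i, k i * (g i).degreeOf t := by
  rw [MvPolynomial.degreeOf_C_mul _ _ (mem_nonZeroDivisors_of_ne_zero hβ),
    MvPolynomial.degreeOf_prod_eq _ _ fun i _ => pow_ne_zero _ (hg i)]
  exact Finset.sum_congr rfl fun i _ => MvPolynomial.degreeOf_pow_eq _ _ _ (hg i)

lemma isUnit_C_of_ne_zero {β : ℂ} (hβ : β ≠ 0) :
    IsUnit (MvPolynomial.C β : MvPolynomial (Fin ℓ) ℂ) :=
  hβ.isUnit.map MvPolynomial.C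

/-- An irreducible complex polynomial involving a single variable has degree one. -/
lemma degreeOf_le_one_of_irreducible {g : MvPolynomial (Fin ℓ) ℂ} (hg : Irreducible g)
    {t : Fin ℓ} (h : ∀ s, s ≠ t → g.degreeOf s = 0) : g.degreeOf t ≤ 1 := by
  have hmem : g ∈ MvPolynomial.supported ℂ ({t} : Set (Fin ℓ)) := by
    rw [MvPolynomial.mem_supported]
    intro s hs
    by_contra hst
    exact MvPolynomial.mem_vars_iff_degreeOf_ne_zero.1 hs (h s hst)
  rw [MvPolynomial.supported_eq_adjoin_X, Set.image_singleton,
    Algebra.adjoin_singleton_eq_range_aeval] at hmem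
  obtain ⟨p, rfl⟩ := hmem
  change Irreducible (Polynomial.aeval (MvPolynomial.X t) p) at hg
  change MvPolynomial.degreeOf t (Polynomial.aeval (MvPolynomial.X t) p) ≤ 1
  have hp : p.degree ≠ 0 := by
    intro hp
    rw [Polynomial.eq_C_of_degree_eq_zero hp, Polynomial.aeval_C] at hg
    refine hg.not_isUnit (isUnit_C_of_ne_zero ?_)
    rintro h0
    exact hg.ne_zero (by rw [h0, map_zero])
  obtain ⟨z, hz⟩ := IsAlgClosed.exists_root p hp
  obtain ⟨q, rfl⟩ := Polynomial.dvd_iff_isRoot.2 hz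
  have hfac : Polynomial.aeval (MvPolynomial.X t) ((Polynomial.X - Polynomial.C z) * q) =
      (MvPolynomial.X t - MvPolynomial.C z : MvPolynomial (Fin ℓ) ℂ) *
        Polynomial.aeval (MvPolynomial.X t) q := by
    simp [MvPolynomial.algebraMap_eq]
  rw [hfac] at hg ⊢
  have hlin : (MvPolynomial.X t - MvPolynomial.C z : MvPolynomial (Fin ℓ) ℂ).degreeOf t ≤ 1 := by
    refine (MvPolynomial.degreeOf_sub_le _ _ _).trans ?_
    simp [MvPolynomial.degreeOf_C]
  rcases hg.isUnit_or_isUnit rfl with hu | hu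
  · exfalso
    have := hu.map (MvPolynomial.eval fun _ => z)
    simp at this
  · obtain ⟨c, -, hc⟩ := MvPolynomial.isUnit_iff_eq_C_of_isReduced.1 hu
    rw [hc]
    refine (MvPolynomial.degreeOf_mul_le _ _ _).trans ?_
    simpa [MvPolynomial.degreeOf_C] using hlin

lemma strictWeight_of_irreducible {g : MvPolynomial (Fin ℓ) ℂ} (hg : Irreducible g)
    {m : Fin ℓ → ℕ} (hdeg : ∀ t, g.degreeOf t = m t) : StrictWeight m := by
  intro a b ha hb hab
  obtain ⟨s, hs⟩ := Function.ne_iff.1 ha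
  obtain ⟨t, ht⟩ := Function.ne_iff.1 hb
  simp only [Pi.zero_apply] at hs ht
  by_cases hex : ∃ s t, s ≠ t ∧ a s ≠ 0 ∧ b t ≠ 0
  · obtain ⟨s, t, hst, hs, ht⟩ := hex
    exact hab ▸ degWeight_add_lt hst hs ht
  · push Not at hex
    obtain rfl : s = t := by
      by_contra hst
      exact ht (hex s t hst hs)
    have hle : g.degreeOf s ≤ 1 := degreeOf_le_one_of_irreducible hg fun u hu => by
      have hb0 := hex s u hu.symm hs
      have ha0 : a u = 0 := by
        by_contra h
        exact ht (hex u s hu h)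
      rw [hdeg, ← hab, Pi.add_apply, ha0, hb0]
    rw [hdeg, ← hab, Pi.add_apply] at hle
    omega

lemma FMset_subset_of_equiv {r r' : ℕ} {mdeg : Fin r → Fin ℓ → ℕ} {k : Fin r → ℕ}
    {mdeg' : Fin r' → Fin ℓ → ℕ} {k' : Fin r' → ℕ} (σ : Fin r ≃ Fin r')
    (hdeg : ∀ j, mdeg j = mdeg' (σ j)) (hk : ∀ j, k j = k' (σ j)) :
    FMset r mdeg k ⊆ FMset r' mdeg' k' := by
  rintro f ⟨β, g, hβ, hirr, hd, hna, rfl⟩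
  refine ⟨β, g ∘ σ.symm, hβ, fun i => hirr _, fun i t => ?_, fun i j hij => ?_, ?_⟩
  · simp [hd, hdeg]
  · exact hna _ _ (σ.symm.injective.ne hij)
  · rw [← Equiv.prod_comp σ]
    simp [hk]

lemma FMset_eq_of_equiv {r r' : ℕ} {mdeg : Fin r → Fin ℓ → ℕ} {k : Fin r → ℕ}
    {mdeg' : Fin r' → Fin ℓ → ℕ} {k' : Fin r' → ℕ} (σ : Fin r ≃ Fin r')
    (hdeg : ∀ j, mdeg j = mdeg' (σ j)) (hk : ∀ j, k j = k' (σ j)) :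
    FMset r mdeg k = FMset r' mdeg' k' :=
  (FMset_subset_of_equiv σ hdeg hk).antisymm
    (FMset_subset_of_equiv σ.symm (fun j => by simp [hdeg]) fun j => by simp [hk])

/-- The exponents with which the irreducible factors of a polynomial are distributed over the
factors of a coarser factorization. -/
lemma exists_exponents {r n : ℕ} {β γ : ℂ} (hβ : β ≠ 0) (hγ : γ ≠ 0)
    {g : Fin n → MvPolynomial (Fin ℓ) ℂ} {nk : Fin n → ℕ} (hirr : ∀ i, Irreducible (g i))
    (hna : ∀ i j, i ≠ j → ¬ Associated (g i) (g j))
    {h : Fin r → MvPolynomial (Fin ℓ) ℂ} {k : Fin r → ℕ} (hk : ∀ j, 1 ≤ k j)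
    (heq : MvPolynomial.C β * ∏ i, g i ^ nk i = MvPolynomial.C γ * ∏ j, h j ^ k j) :
    ∃ a : Fin r → Fin n → ℕ, (∀ i, nk i = ∑ j, k j * a j i) ∧
      ∀ j t, (h j).degreeOf t = ∑ i, a j i * (g i).degreeOf t := by
  have hp : ∀ i, Prime (g i) := fun i => (hirr i).prime
  have hfac : ∀ j, ∃ (a : Fin n → ℕ) (u : MvPolynomial (Fin ℓ) ℂ), IsUnit u ∧
      h j = u * ∏ i, g i ^ a i := by
    intro j
    have hdvd : h j ∣ MvPolynomial.C β * ∏ i, g i ^ nk i := by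
      rw [heq]
      exact ((dvd_pow_self _ (Nat.one_le_iff_ne_zero.1 (hk j))).trans
        (Finset.dvd_prod_of_mem (fun j => h j ^ k j) (Finset.mem_univ j))).mul_left _
    obtain ⟨y, hy⟩ := hdvd
    obtain ⟨e, b, hb, he⟩ := exists_eq_mul_prod_pow_of_mul_eq Finset.univ hp hy.symm
    exact ⟨e, b, isUnit_of_dvd_unit hb (isUnit_C_of_ne_zero hβ), he⟩
  choose a u hu ha using hfac
  refine ⟨a, fun i => ?_, fun j t => ?_⟩
  · have h1 := emultiplicity_unit_mul_prod_pow (isUnit_C_of_ne_zero hβ) hp hna nk i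
    rw [heq, emultiplicity_mul (hp i), Finset.emultiplicity_prod (hp i), emultiplicity_eq_zero.2
      fun h => (hp i).not_isUnit (isUnit_of_dvd_unit h (isUnit_C_of_ne_zero hγ)), zero_add] at h1
    have h2 : ∀ j, emultiplicity (g i) (h j ^ k j) = ((k j * a j i : ℕ) : ℕ∞) := fun j => by
      rw [emultiplicity_pow (hp i), ha j, emultiplicity_unit_mul_prod_pow (hu j) hp hna]
      push_cast
      rfl
    simp only [h2] at h1
    exact_mod_cast h1.symm
  · obtain ⟨c, hc, hcu⟩ := MvPolynomial.isUnit_iff_eq_C_of_isReduced.1 (hu j)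
    rw [ha j, hcu, degreeOf_C_mul_prod_pow hc.ne_zero fun i => (hirr i).ne_zero]

end Algebra

section Analysis

open Filter Topology

variable {ℓ : ℕ}

lemma pNorm_eq_sqrt_sum {p : MvPolynomial (Fin ℓ) ℂ} {s : Finset (Fin ℓ →₀ ℕ)}
    (hs : p.support ⊆ s) : pNorm p = √(∑ d ∈ s, ‖p.coeff d‖ ^ 2) := by
  have h : (pInner p p).re = ∑ d ∈ p.support, ‖p.coeff d‖ ^ 2 := by
    simp only [pInner, Finset.union_self, Complex.re_sum]
    refine Finset.sum_congr rfl fun d _ => ?_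
    rw [← Complex.normSq_eq_conj_mul_self, Complex.ofReal_re, Complex.normSq_eq_norm_sq]
  rw [pNorm, h]
  congr 1
  refine Finset.sum_subset hs fun d _ hd => ?_
  rw [MvPolynomial.notMem_support_iff.1 hd]
  simp

lemma pNorm_eq_norm {p : MvPolynomial (Fin ℓ) ℂ} {s : Finset (Fin ℓ →₀ ℕ)}
    (hs : p.support ⊆ s) :
    pNorm p = ‖(WithLp.toLp 2 fun d : s => p.coeff d : EuclideanSpace ℂ s)‖ := by
  rw [pNorm_eq_sqrt_sum hs, EuclideanSpace.norm_eq, ← Finset.sum_coe_sort]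

lemma pNorm_sub_le (p q r : MvPolynomial (Fin ℓ) ℂ) :
    pNorm (p - r) ≤ pNorm (q - p) + pNorm (q - r) := by
  have hp : (p - r).support ⊆ (p - r).support ∪ ((q - p).support ∪ (q - r).support) :=
    Finset.subset_union_left
  have hq : (q - p).support ⊆ (p - r).support ∪ ((q - p).support ∪ (q - r).support) :=
    Finset.subset_union_left.trans Finset.subset_union_right
  have hr : (q - r).support ⊆ (p - r).support ∪ ((q - p).support ∪ (q - r).support) :=
    Finset.subset_union_right.trans Finset.subset_union_right
  rw [pNorm_eq_norm hp, pNorm_eq_norm hq, pNorm_eq_norm hr, add_comm]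
  refine le_of_eq_of_le (congrArg norm ?_) (norm_sub_le _ _)
  ext d
  simp

lemma norm_coeff_le_pNorm (p : MvPolynomial (Fin ℓ) ℂ) (d : Fin ℓ →₀ ℕ) :
    ‖p.coeff d‖ ≤ pNorm p := by
  rw [pNorm_eq_norm (Finset.subset_insert d p.support)]
  exact PiLp.norm_apply_le
    (WithLp.toLp 2 fun e : (insert d p.support : Finset _) => p.coeff e : EuclideanSpace ℂ _)
    ⟨d, Finset.mem_insert_self _ _⟩

/-- Coefficientwise convergence of polynomials along a filter. -/
def CoeffTendsto {α : Type*} (u : Filter α) (p : α → MvPolynomial (Fin ℓ) ℂ)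
    (q : MvPolynomial (Fin ℓ) ℂ) : Prop :=
  ∀ d, Tendsto (fun x => (p x).coeff d) u (𝓝 (q.coeff d))

namespace CoeffTendsto

variable {α : Type*} {u : Filter α}

lemma const (q : MvPolynomial (Fin ℓ) ℂ) : CoeffTendsto u (fun _ => q) q :=
  fun _ => tendsto_const_nhds

lemma mul {p p' : α → MvPolynomial (Fin ℓ) ℂ} {q q' : MvPolynomial (Fin ℓ) ℂ}
    (h : CoeffTendsto u p q) (h' : CoeffTendsto u p' q') :
    CoeffTendsto u (fun x => p x * p' x) (q * q') := fun d => by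
  simp only [MvPolynomial.coeff_mul]
  exact tendsto_finsetSum _ fun e _ => (h e.1).mul (h' e.2)

lemma pow {p : α → MvPolynomial (Fin ℓ) ℂ} {q : MvPolynomial (Fin ℓ) ℂ}
    (h : CoeffTendsto u p q) (k : ℕ) : CoeffTendsto u (fun x => p x ^ k) (q ^ k) := by
  induction k with
  | zero => simpa using const 1
  | succ k ih => simpa only [pow_succ] using ih.mul h

lemma prod {ι : Type*} (s : Finset ι) {p : ι → α → MvPolynomial (Fin ℓ) ℂ}
    {q : ι → MvPolynomial (Fin ℓ) ℂ} (h : ∀ i, CoeffTendsto u (p i) (q i)) :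
    CoeffTendsto u (fun x => ∏ i ∈ s, p i x) (∏ i ∈ s, q i) := by
  induction s using Finset.induction_on with
  | empty => simpa using const 1
  | insert i s hi ih => simpa only [Finset.prod_insert hi] using (h i).mul ih

/-- If `C (β x) * p x` converges and `p x` converges to a nonzero limit `q`, then the limit is a
scalar multiple of `q`. -/
lemma exists_eq_C_mul [u.NeBot] {β : α → ℂ} {p : α → MvPolynomial (Fin ℓ) ℂ}
    {q f : MvPolynomial (Fin ℓ) ℂ} (hp : CoeffTendsto u p q) (hq : q ≠ 0)
    (hf : CoeffTendsto u (fun x => MvPolynomial.C (β x) * p x) f) :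
    ∃ b, f = MvPolynomial.C b * q := by
  obtain ⟨d, hd⟩ := MvPolynomial.ne_zero_iff.1 hq
  have hβ : Tendsto β u (𝓝 (f.coeff d / q.coeff d)) := by
    refine ((hf d).div (hp d) hd).congr' ?_
    filter_upwards [(hp d).eventually_ne hd] with x hx
    rw [Pi.div_apply, MvPolynomial.coeff_C_mul, mul_div_cancel_right₀ _ hx]
  refine ⟨f.coeff d / q.coeff d, MvPolynomial.ext _ _ fun e => ?_⟩
  refine tendsto_nhds_unique (hf e) ?_
  simp only [MvPolynomial.coeff_C_mul]
  exact hβ.mul (hp e)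

end CoeffTendsto

/-- The sum of the absolute values of the coefficients. -/
noncomputable def coeffSum (p : MvPolynomial (Fin ℓ) ℂ) : ℝ := ∑ d ∈ p.support, ‖p.coeff d‖

lemma coeffSum_eq {p : MvPolynomial (Fin ℓ) ℂ} {s : Finset (Fin ℓ →₀ ℕ)}
    (hs : p.support ⊆ s) : coeffSum p = ∑ d ∈ s, ‖p.coeff d‖ :=
  Finset.sum_subset hs fun d _ hd => by simp [MvPolynomial.notMem_support_iff.1 hd]

lemma norm_coeff_le_coeffSum (p : MvPolynomial (Fin ℓ) ℂ) (d : Fin ℓ →₀ ℕ) :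
    ‖p.coeff d‖ ≤ coeffSum p := by
  rw [coeffSum_eq (Finset.subset_insert d p.support)]
  exact Finset.single_le_sum (f := fun d => ‖p.coeff d‖) (fun _ _ => norm_nonneg _)
    (Finset.mem_insert_self _ _)

lemma coeffSum_pos {p : MvPolynomial (Fin ℓ) ℂ} (hp : p ≠ 0) : 0 < coeffSum p := by
  obtain ⟨d, hd⟩ := MvPolynomial.ne_zero_iff.1 hp
  exact (norm_pos_iff.2 hd).trans_le (norm_coeff_le_coeffSum p d)

lemma coeffSum_C_mul (c : ℂ) (p : MvPolynomial (Fin ℓ) ℂ) :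
    coeffSum (MvPolynomial.C c * p) = ‖c‖ * coeffSum p := by
  have hs : (MvPolynomial.C c * p).support ⊆ p.support := by
    intro d hd
    rw [MvPolynomial.mem_support_iff, MvPolynomial.coeff_C_mul] at hd
    exact MvPolynomial.mem_support_iff.2 (right_ne_zero_of_mul hd)
  rw [coeffSum_eq hs, coeffSum, Finset.mul_sum]
  simp

/-- Normalized polynomials of bounded multidegree have nonzero limits along ultrafilters. -/
lemma exists_coeffTendsto {α : Type*} (u : Ultrafilter α) {m : Fin ℓ → ℕ}
    {p : α → MvPolynomial (Fin ℓ) ℂ} (hdeg : ∀ x t, (p x).degreeOf t ≤ m t)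
    (hp : ∀ x, coeffSum (p x) = 1) :
    ∃ q : MvPolynomial (Fin ℓ) ℂ, q ≠ 0 ∧ (∀ t, q.degreeOf t ≤ m t) ∧ CoeffTendsto u p q := by
  have hlim : ∀ d, ∃ z : ℂ, Tendsto (fun x => (p x).coeff d) u (𝓝 z) := fun d => by
    obtain ⟨z, -, hz⟩ := (isCompact_closedBall (0 : ℂ) 1).ultrafilter_le_nhds
      (u.map fun x => (p x).coeff d) (by
        rw [le_principal_iff]
        refine Ultrafilter.mem_map.2 (Filter.univ_mem' fun x => ?_)
        simpa using (norm_coeff_le_coeffSum (p x) d).trans_eq (hp x))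
    exact ⟨z, hz⟩
  choose z hz using hlim
  set s : Finset (Fin ℓ →₀ ℕ) := Finset.Iic (Finsupp.equivFunOnFinite.symm m) with hs
  have hmem : ∀ d, d ∈ s ↔ ∀ t, d t ≤ m t := fun d => by
    simp [hs, Finsupp.le_def]
  have hsupp : ∀ x, (p x).support ⊆ s := fun x d hd =>
    (hmem d).2 fun t => (MvPolynomial.degreeOf_le_iff.1 (hdeg x t)) d hd
  set q : MvPolynomial (Fin ℓ) ℂ := ∑ d ∈ s, MvPolynomial.monomial d (z d) with hq
  have hcoeff : ∀ d, q.coeff d = if d ∈ s then z d else 0 := fun d => by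
    simp [hq, MvPolynomial.coeff_sum, MvPolynomial.coeff_monomial]
  have htend : CoeffTendsto u p q := fun d => by
    rw [hcoeff]
    split_ifs with hd
    · exact hz d
    · refine tendsto_const_nhds.congr fun x => ?_
      exact (MvPolynomial.notMem_support_iff.1 fun h => hd (hsupp x h)).symm
  refine ⟨q, ?_, fun t => MvPolynomial.degreeOf_le_iff.2 fun d hd => ?_, htend⟩
  · rintro h0
    have hsum : Tendsto (fun x => ∑ d ∈ s, ‖(p x).coeff d‖) u (𝓝 (∑ d ∈ s, ‖q.coeff d‖)) :=
      tendsto_finsetSum _ fun d _ => (htend d).norm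
    have hone : (fun x => ∑ d ∈ s, ‖(p x).coeff d‖) = fun _ => 1 :=
      funext fun x => by rw [← coeffSum_eq (hsupp x), hp x]
    rw [hone] at hsum
    have := tendsto_nhds_unique hsum tendsto_const_nhds
    simp [h0] at this
  · rw [MvPolynomial.mem_support_iff, hcoeff] at hd
    exact (hmem d).1 (by_contra fun h => hd (if_neg h)) t

/-- A nonzero polynomial in the closure of a factorization manifold has a factorization of the
corresponding shape, with factors that need not be irreducible. -/
lemma exists_factorization_of_mem_pclosure {r : ℕ} {mdeg : Fin r → Fin ℓ → ℕ} {k : Fin r → ℕ}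
    {f : MvPolynomial (Fin ℓ) ℂ} (hf0 : f ≠ 0) (hf : f ∈ pclosure (FMset r mdeg k)) :
    ∃ (β : ℂ) (h : Fin r → MvPolynomial (Fin ℓ) ℂ), β ≠ 0 ∧ (∀ j, h j ≠ 0) ∧
      (∀ j t, (h j).degreeOf t ≤ mdeg j t) ∧ f = MvPolynomial.C β * ∏ j, h j ^ k j := by
  choose F hF hdist using fun n : ℕ => hf (1 / ((n : ℝ) + 1)) (by positivity)
  choose β g hβ hirr hdeg hna hFeq using hF
  have hne : ∀ n j, g n j ≠ 0 := fun n j => (hirr n j).ne_zero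
  have hpos : ∀ n j, coeffSum (g n j) ≠ 0 := fun n j => (coeffSum_pos (hne n j)).ne'
  set p : Fin r → ℕ → MvPolynomial (Fin ℓ) ℂ := fun j n =>
    MvPolynomial.C ((coeffSum (g n j) : ℂ)⁻¹) * g n j with hp
  have hlim : ∀ j, ∃ q : MvPolynomial (Fin ℓ) ℂ, q ≠ 0 ∧ (∀ t, q.degreeOf t ≤ mdeg j t) ∧
      CoeffTendsto (hyperfilter ℕ : Filter ℕ) (p j) q := fun j => by
    refine exists_coeffTendsto (hyperfilter ℕ) (fun n t => ?_) fun n => ?_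
    · exact (MvPolynomial.degreeOf_C_mul_le _ _ _).trans (hdeg n j t).le
    · rw [hp, coeffSum_C_mul, norm_inv, Complex.norm_real, Real.norm_of_nonneg
        (coeffSum_pos (hne n j)).le, inv_mul_cancel₀ (hpos n j)]
  choose h hh0 hhdeg hhlim using hlim
  have hprod : CoeffTendsto (hyperfilter ℕ : Filter ℕ) (fun n => ∏ j, p j n ^ k j)
      (∏ j, h j ^ k j) := CoeffTendsto.prod _ fun j => (hhlim j).pow (k j)
  have hFp : ∀ n, MvPolynomial.C (β n * ∏ j, (coeffSum (g n j) : ℂ) ^ k j) *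
      ∏ j, p j n ^ k j = F n := fun n => by
    rw [hFeq, map_mul, map_prod, mul_assoc, ← Finset.prod_mul_distrib]
    congr 1
    refine Finset.prod_congr rfl fun j _ => ?_
    rw [map_pow, ← mul_pow, hp]
    simp only
    rw [← mul_assoc, ← map_mul, mul_inv_cancel₀ (by exact_mod_cast hpos n j), map_one, one_mul]
  have hFlim : CoeffTendsto (hyperfilter ℕ : Filter ℕ) (fun n =>
      MvPolynomial.C (β n * ∏ j, (coeffSum (g n j) : ℂ) ^ k j) * ∏ j, p j n ^ k j) f := by
    simp only [hFp]
    intro d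
    refine Tendsto.mono_left ?_ Nat.hyperfilter_le_atTop
    rw [tendsto_iff_norm_sub_tendsto_zero]
    refine squeeze_zero (fun _ => norm_nonneg _) (fun n => ?_)
      (tendsto_one_div_add_atTop_nhds_zero_nat (𝕜 := ℝ))
    rw [norm_sub_rev, ← MvPolynomial.coeff_sub]
    exact (norm_coeff_le_pNorm _ d).trans (hdist n).le
  obtain ⟨b, hb⟩ := hprod.exists_eq_C_mul
    (Finset.prod_ne_zero_iff.2 fun j _ => pow_ne_zero _ (hh0 j)) hFlim
  refine ⟨b, h, ?_, hh0, hhdeg, hb⟩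
  rintro rfl
  exact hf0 (by rw [hb, map_zero, zero_mul])

end Analysis

/-- If a point of `F^𝔑` lies in the closure of `F^𝔐`, then `codim 𝔐 ≤ codim 𝔑`, with equality only
if the two manifolds agree. -/
lemma codimOf_le_of_mem_pclosure {ℓ : ℕ} {m : Fin ℓ → ℕ} {n r : ℕ}
    {ndeg : Fin n → Fin ℓ → ℕ} {nk : Fin n → ℕ} (hN : IsStruct m n ndeg nk)
    {mdeg : Fin r → Fin ℓ → ℕ} {k : Fin r → ℕ} (hM : IsStruct m r mdeg k)
    {f : MvPolynomial (Fin ℓ) ℂ} (hfN : f ∈ FMset n ndeg nk)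
    (hfM : f ∈ pclosure (FMset r mdeg k)) :
    codimOf m mdeg ≤ codimOf m ndeg ∧
      (codimOf m mdeg = codimOf m ndeg → FMset r mdeg k = FMset n ndeg nk) := by
  obtain ⟨-, hn0, hnk, hnsum⟩ := hN
  obtain ⟨-, hm0, hk, hmsum⟩ := hM
  obtain ⟨_, ⟨_, g', -, hirr', hdeg', -⟩, -⟩ := hfM 1 one_pos
  obtain ⟨β, g, hβ, hirr, hdeg, hna, rfl⟩ := hfN
  have hg0 : ∀ i, g i ≠ 0 := fun i => (hirr i).ne_zero
  obtain ⟨γ, h, hγ, hh0, hhle, heq⟩ := exists_factorization_of_mem_pclosure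
    (mul_ne_zero (isUnit_C_of_ne_zero hβ).ne_zero
      (Finset.prod_ne_zero_iff.2 fun i _ => pow_ne_zero _ (hg0 i))) hfM
  have hhdeg : ∀ j t, (h j).degreeOf t = mdeg j t := fun j t => by
    have h1 : ∑ j, k j * (h j).degreeOf t = ∑ j, k j * mdeg j t := by
      rw [← degreeOf_C_mul_prod_pow hγ hh0, ← heq, degreeOf_C_mul_prod_pow hβ hg0, hmsum, ← hnsum]
      simp only [hdeg]
    have h2 := (Finset.sum_eq_sum_iff_of_le
      fun j _ => Nat.mul_le_mul_left (k j) (hhle j t)).1 h1 j (Finset.mem_univ _)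
    exact Nat.eq_of_mul_eq_mul_left (hk j) h2
  obtain ⟨a, hak, hadeg⟩ := exists_exponents hβ hγ hirr hna hk heq
  have hsum : ∀ j, ∑ i, a j i • ndeg i = mdeg j := fun j => by
    funext t
    rw [← hhdeg, hadeg]
    simp [hdeg]
  have hcover : ∀ i, ∃ j, a j i ≠ 0 := fun i => by
    by_contra! h0
    have h1 := hnk i
    simp [hak i, h0] at h1
  obtain ⟨hle, hstrict⟩ := sum_degWeight_le_sum_degWeight hn0 hsum hcover
  rw [codimOf_eq_sub_sum_degWeight, codimOf_eq_sub_sum_degWeight]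
  refine ⟨by linarith, fun hcod => ?_⟩
  obtain ⟨σ, hσ⟩ := hstrict (by linarith) hm0
    fun j => strictWeight_of_irreducible (hirr' j) (hdeg' j)
  refine FMset_eq_of_equiv σ (fun j => ?_) fun j => ?_
  · rw [← hsum j, hσ j]
    simp [Pi.single_apply]
  · rw [hak (σ j)]
    simp [hσ, Pi.single_apply]

lemma mem_pclosure_of_distE_lt {ℓ : ℕ} {m : Fin ℓ → ℕ} {r : ℕ} {mdeg : Fin r → Fin ℓ → ℕ}
    {k : Fin r → ℕ} (hM : IsStruct m r mdeg k) {f ft : MvPolynomial (Fin ℓ) ℂ}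
    (hclose : ENNReal.ofReal (pNorm (f - ft)) < theta m ft / 2)
    (hdist : distE f (FMset r mdeg k) < theta m ft / 2) : ft ∈ pclosure (FMset r mdeg k) := by
  by_contra hnot
  obtain ⟨g, hg⟩ := iInf_lt_iff.1 hdist
  obtain ⟨hgF, hg⟩ := iInf_lt_iff.1 hg
  have h1 : theta m ft ≤ ENNReal.ofReal (pNorm (ft - g)) := by
    have h : distE ft (FMset r mdeg k) ≤ ENNReal.ofReal (pNorm (ft - g)) :=
      iInf_le_of_le g (iInf_le_of_le hgF le_rfl)
    refine le_trans ?_ h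
    exact iInf_le_of_le r <| iInf_le_of_le mdeg <| iInf_le_of_le k <| iInf_le_of_le hM <|
      iInf_le_of_le hnot le_rfl
  have h2 : ENNReal.ofReal (pNorm (ft - g)) ≤
      ENNReal.ofReal (pNorm (f - ft)) + ENNReal.ofReal (pNorm (f - g)) :=
    (ENNReal.ofReal_le_ofReal (pNorm_sub_le ft f g)).trans ENNReal.ofReal_add_le
  have h3 := ENNReal.add_lt_add hclose hg
  rw [ENNReal.add_halves] at h3
  exact absurd (h1.trans h2) h3.not_ge

/-- Structure identification: if `f̃ ∈ F^𝔑` and the data `f ∈ ℙ^m` satisfies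
`‖f − f̃‖ < θ_{f̃}/2`, then for every `ε` with `dist(f, F^𝔑) < ε < θ_{f̃}/2`, the structure
`𝔑` attains the maximal codimension among all factorization structures `𝔐` of degree `m`
with `dist(f, F^𝔐) < ε`, and is the unique such structure (i.e. any structure with
`dist(f,F^𝔐) < ε` of the same codimension has the same factorization manifold). -/
theorem structure_identification (ℓ : ℕ) (hl : 1 ≤ ℓ) (m : Fin ℓ → ℕ) (hm : m ≠ 0)
    (rN : ℕ) (ndeg : Fin rN → Fin ℓ → ℕ) (nk : Fin rN → ℕ)
    (hN : IsStruct m rN ndeg nk)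
    (ft : MvPolynomial (Fin ℓ) ℂ) (hft : ft ∈ FMset rN ndeg nk)
    (f : MvPolynomial (Fin ℓ) ℂ) (hfP : ∀ t, f.degreeOf t ≤ m t)
    (hclose : ENNReal.ofReal (pNorm (f - ft)) < theta m ft / 2) :
    ∀ ε : ℝ, distE f (FMset rN ndeg nk) < ENNReal.ofReal ε →
      ENNReal.ofReal ε < theta m ft / 2 →
      (∀ (r' : ℕ) (mdeg' : Fin r' → Fin ℓ → ℕ) (k' : Fin r' → ℕ),
        IsStruct m r' mdeg' k' → distE f (FMset r' mdeg' k') < ENNReal.ofReal ε →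
        codimOf m mdeg' ≤ codimOf m ndeg) ∧
      (∀ (r' : ℕ) (mdeg' : Fin r' → Fin ℓ → ℕ) (k' : Fin r' → ℕ),
        IsStruct m r' mdeg' k' → distE f (FMset r' mdeg' k') < ENNReal.ofReal ε →
        codimOf m mdeg' = codimOf m ndeg → FMset r' mdeg' k' = FMset rN ndeg nk) := by
  intro ε _ hε
  refine ⟨fun r mdeg k hM hd => ?_, fun r mdeg k hM hd => ?_⟩
  · exact (codimOf_le_of_mem_pclosure hN hM hft
      (mem_pclosure_of_distE_lt hM hclose (hd.trans hε))).1
  · exact (codimOf_le_of_mem_pclosure hN hM hft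
      (mem_pclosure_of_distE_lt hM hclose (hd.trans hε))).2
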